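/- arXiv:1501.06169 — 2 statements merged into one kernel-verified Lean document; each statement's English description precedes it below -/
import Mathlib

section
/- Let Y be a ℤ-module, Q : Y → ℤ a quadratic map, v ∈ Y, f : Y → ℤ ℤ-linear with f(v) = 2, and suppose Q is invariant under the reflection s(y) = y − f(y) • v. Let n be a positive integer and set n_v = n / gcd(n, Q(v)). Then for every y ∈ Y: n divides B_Q(v, y) if and only if n_v divides f(y). (This is the paper's equation (BetaObs): β_Q(φ∨, y) ∈ ℤ if and only if ⟨φ, y⟩ ∈ n_φ ℤ.) -/
/-- The polar form `B_Q(y₁, y₂) = Q(y₁ + y₂) − Q(y₁) − Q(y₂)` of a map `Q : Y → ℤ`. -/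
def polarForm {Y : Type*} [AddCommGroup Y] (Q : Y → ℤ) (y₁ y₂ : Y) : ℤ :=
  Q (y₁ + y₂) - Q y₁ - Q y₂

/-- `Q : Y → ℤ` is a quadratic map: `Q(k • y) = k² Q(y)` and the polar form is
additive (hence, by symmetry, ℤ-bilinear). -/
def IsQuadraticMap {Y : Type*} [AddCommGroup Y] (Q : Y → ℤ) : Prop :=
  (∀ (k : ℤ) (y : Y), Q (k • y) = k ^ 2 * Q y) ∧
  (∀ y₁ y₂ y₃ : Y, polarForm Q (y₁ + y₂) y₃ = polarForm Q y₁ y₃ + polarForm Q y₂ y₃)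

theorem polarForm_comm {Y : Type*} [AddCommGroup Y] (Q : Y → ℤ) (x y : Y) :
    polarForm Q x y = polarForm Q y x := by
  unfold polarForm
  rw [add_comm x y]
  ring

theorem IsQuadraticMap.polarForm_zsmul_left {Y : Type*} [AddCommGroup Y] {Q : Y → ℤ}
    (hQ : IsQuadraticMap Q) (k : ℤ) (x y : Y) :
    polarForm Q (k • x) y = k * polarForm Q x y := by
  simpa using map_zsmul (AddMonoidHom.mk' (fun z => polarForm Q z y) fun a b => hQ.2 a b y) k x

theorem IsQuadraticMap.polarForm_self {Y : Type*} [AddCommGroup Y] {Q : Y → ℤ}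
    (hQ : IsQuadraticMap Q) (x : Y) : polarForm Q x x = 2 * Q x := by
  have h := hQ.1 2 x
  rw [two_zsmul] at h
  unfold polarForm
  linarith

/-- For a reflection-invariant quadratic map, `B_Q(v, y) = f(y) Q(v)`. -/
theorem IsQuadraticMap.polarForm_eq_mul {Y : Type*} [AddCommGroup Y] {Q : Y → ℤ}
    (hQ : IsQuadraticMap Q) {v : Y} {f : Y →ₗ[ℤ] ℤ} (hfv : f v = 2)
    (hinv : ∀ y : Y, Q (y - f y • v) = Q y) (y : Y) :
    polarForm Q v y = f y * Q v := by
  have key (z : Y) : f z * (f z * Q v - polarForm Q v z) = 0 := by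
    have h := hQ.polarForm_zsmul_left (-f z) v z
    have hs := hQ.1 (-f z) v
    have hz := hinv z
    rw [sub_eq_neg_add, ← neg_zsmul] at hz
    rw [polarForm, hz, hs] at h
    linarith
  rcases mul_eq_zero.mp (key y) with h | h
  · have hadd : polarForm Q v (y + v) = polarForm Q v y + 2 * Q v := by
      rw [polarForm_comm, hQ.2, hQ.polarForm_self, polarForm_comm]
    have hk := key (y + v)
    rw [map_add, h, hfv, hadd] at hk
    rw [h]
    linarith
  · linarith

theorem Int.natCast_dvd_mul_iff_div_gcd_dvd {n : ℕ} (hn : 0 < n) (a b : ℤ) :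
    (n : ℤ) ∣ a * b ↔ ((n / Int.gcd n b : ℕ) : ℤ) ∣ a := by
  have hg : 0 < Nat.gcd n b.natAbs := Nat.gcd_pos_of_pos_left _ hn
  have hgn : Nat.gcd n b.natAbs ∣ n := Nat.gcd_dvd_left ..
  have hgb : Nat.gcd n b.natAbs ∣ b.natAbs := Nat.gcd_dvd_right ..
  rw [Int.natCast_dvd, Int.natCast_dvd, Int.natAbs_mul]
  change n ∣ _ ↔ n / Nat.gcd n b.natAbs ∣ _
  rw [← (Nat.coprime_div_gcd_div_gcd hg).dvd_mul_right, ← Nat.mul_div_assoc _ hgb,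
    Nat.div_dvd_iff_dvd_mul hgn hg, Nat.mul_div_cancel' (hgb.mul_left _)]

/-- (BetaObs): with `n_v = n / gcd(n, Q(v))`, for every `y` one has
`n ∣ B_Q(v, y)` if and only if `n_v ∣ f(y)`; i.e. `β_Q(φ∨, y) ∈ ℤ ↔ ⟨φ, y⟩ ∈ n_φ ℤ`. -/
theorem betaObs {Y : Type*} [AddCommGroup Y]
    (Q : Y → ℤ) (hQ : IsQuadraticMap Q)
    (v : Y) (f : Y →ₗ[ℤ] ℤ) (hfv : f v = 2)
    (hinv : ∀ y : Y, Q (y - f y • v) = Q y)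
    (n : ℕ) (hn : 0 < n) :
    ∀ y : Y, ((n : ℤ) ∣ polarForm Q v y ↔ ((n / Int.gcd (n : ℤ) (Q v) : ℕ) : ℤ) ∣ f y) := by
  intro y
  rw [hQ.polarForm_eq_mul hfv hinv, Int.natCast_dvd_mul_iff_div_gcd_dvd hn]
end

section
/- Let Y be a ℤ-module, Q : Y → ℤ a quadratic map, v ∈ Y, f : Y → ℤ ℤ-linear with f(v) = 2, and suppose Q is invariant under the reflection s(y) = y − f(y) • v. Let n be a positive integer and set n_v = n / gcd(n, Q(v)), m_v = Q(v) / gcd(n, Q(v)). Then the modified coroot n_v • v lies in Y_{Q,n} (that is, n divides B_Q(n_v • v, y) for every y ∈ Y), and moreover Q(n_v • v) = n_v · m_v · n; in particular n divides Q(n_v • v). (This is the paper's claim that the modified coroots φ̃∨ = n_φ φ∨ lie in Y_{Q,n} and Q(φ̃∨) = n_φ m_φ n ∈ nℤ.) -/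
/-- The sublattice `Y_{Q,n} = {y : n ∣ B_Q(y, y′) for all y′}`. -/
def latticeQn {Y : Type*} [AddCommGroup Y] (Q : Y → ℤ) (n : ℕ) : Set Y :=
  {y : Y | ∀ y' : Y, (n : ℤ) ∣ polarForm Q y y'}

namespace IsQuadraticMap

variable {Y : Type*} [AddCommGroup Y] {Q : Y → ℤ}

theorem polarForm_zsmul_left_s5 (hQ : IsQuadraticMap Q) (k : ℤ) (x y : Y) :
    polarForm Q (k • x) y = k * polarForm Q x y := by
  simpa using map_zsmul (AddMonoidHom.mk' (fun z => polarForm Q z y) fun a b => hQ.2 a b y) k x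

theorem polarForm_self_s5 (hQ : IsQuadraticMap Q) (x : Y) : polarForm Q x x = 2 * Q x := by
  have h := hQ.1 2 x
  rw [two_smul] at h
  unfold polarForm
  linarith

/-- Invariance under the reflection `y ↦ y - f y • v` determines the polar form against `v`. -/
theorem polarForm_eq_of_reflection_invariant (hQ : IsQuadraticMap Q) {v : Y} {f : Y →ₗ[ℤ] ℤ}
    (hfv : f v = 2) (hinv : ∀ y : Y, Q (y - f y • v) = Q y) (y : Y) :
    polarForm Q v y = f y * Q v := by
  have key : ∀ z : Y, f z ≠ 0 → polarForm Q v z = f z * Q v := by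
    intro z hz
    have h := hQ.polarForm_zsmul_left_s5 (-f z) v z
    have hq := hQ.1 (-f z) v
    have hi := hinv z
    rw [sub_eq_neg_add, ← neg_smul] at hi
    rw [polarForm, hi, hq] at h
    apply mul_left_cancel₀ hz
    linarith
  by_cases hy : f y = 0
  · have h := key (y + v) (by simp [hy, hfv])
    rw [polarForm_comm, hQ.2, hQ.polarForm_self_s5, map_add, hy, hfv, polarForm_comm] at h
    rw [hy]
    linarith
  · exact key y hy

end IsQuadraticMap

/-- The modified coroot `φ̃∨ = n_φ φ∨` lies in `Y_{Q,n}`, and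
`Q(φ̃∨) = n_φ m_φ n ∈ nℤ`. Here `n_v = n / gcd(n, Q(v))` and
`m_v = Q(v) / gcd(n, Q(v))`. -/
theorem modified_coroot_in_YQn {Y : Type*} [AddCommGroup Y]
    (Q : Y → ℤ) (hQ : IsQuadraticMap Q)
    (v : Y) (f : Y →ₗ[ℤ] ℤ) (hfv : f v = 2)
    (hinv : ∀ y : Y, Q (y - f y • v) = Q y)
    (n : ℕ) (hn : 0 < n) :
    (((n / Int.gcd (n : ℤ) (Q v) : ℕ) : ℤ) • v ∈ latticeQn Q n) ∧
    Q (((n / Int.gcd (n : ℤ) (Q v) : ℕ) : ℤ) • v) =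
      ((n / Int.gcd (n : ℤ) (Q v) : ℕ) : ℤ) * (Q v / (Int.gcd (n : ℤ) (Q v) : ℤ)) * (n : ℤ) ∧
    (n : ℤ) ∣ Q (((n / Int.gcd (n : ℤ) (Q v) : ℕ) : ℤ) • v) := by
  have hd : ((n / Int.gcd (n : ℤ) (Q v) : ℕ) : ℤ) * (Int.gcd (n : ℤ) (Q v) : ℤ) = n := by
    exact_mod_cast Nat.div_mul_cancel (by exact_mod_cast Int.gcd_dvd_left (n : ℤ) (Q v))
  have hm : Q v / (Int.gcd (n : ℤ) (Q v) : ℤ) * (Int.gcd (n : ℤ) (Q v) : ℤ) = Q v :=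
    Int.ediv_mul_cancel (Int.gcd_dvd_right _ _)
  generalize ((n / Int.gcd (n : ℤ) (Q v) : ℕ) : ℤ) = d at *
  generalize Q v / (Int.gcd (n : ℤ) (Q v) : ℤ) = m at *
  generalize (Int.gcd (n : ℤ) (Q v) : ℤ) = g at *
  have hQd : Q (d • v) = d * m * n := by
    rw [hQ.1, ← hm, ← hd]
    ring
  refine ⟨fun y => ⟨m * f y, ?_⟩, hQd, hQd ▸ dvd_mul_left _ _⟩
  rw [hQ.polarForm_zsmul_left_s5, hQ.polarForm_eq_of_reflection_invariant hfv hinv, ← hm, ← hd]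
  ring
end
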